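/- Let A and B be graded 𝕜-algebras and let τ: B⊗A → A⊗B be a graded 𝕜-linear map. Define μ_τ = (μ_A⊗μ_B)∘(1_A⊗τ⊗1_B): A⊗B⊗A⊗B → A⊗B. Then: (1) τ is a graded twisting map if and only if μ_τ defines an associative multiplication giving A⊗B the structure of a graded unital algebra; (2) for each n, τ is graded twisting to degree n if and only if μ_τ induces an associative multiplication giving the quotient (A⊗B)/(A⊗B)_{>n} the structure of a graded algebra. -/

import Mathlib

open TensorProduct

noncomputable section

namespace TTP

variable (𝕜 : Type) [Field 𝕜]

/-- The image of `p ⊗ q` inside `M ⊗[𝕜] N`, for submodules `p ⊆ M`, `q ⊆ N`. -/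
def subTmul {M N : Type} [AddCommGroup M] [Module 𝕜 M] [AddCommGroup N] [Module 𝕜 N]
    (p : Submodule 𝕜 M) (q : Submodule 𝕜 N) : Submodule 𝕜 (M ⊗[𝕜] N) :=
  LinearMap.range (TensorProduct.map p.subtype q.subtype)

/-- The Künneth grading on a tensor product of graded vector spaces. -/
def kunneth {M N : Type} [AddCommGroup M] [Module 𝕜 M] [AddCommGroup N] [Module 𝕜 N]
    (𝒜 : ℕ → Submodule 𝕜 M) (ℬ : ℕ → Submodule 𝕜 N) (n : ℕ) : Submodule 𝕜 (M ⊗[𝕜] N) :=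
  ⨆ (pq : ℕ × ℕ) (_ : pq.1 + pq.2 = n), subTmul 𝕜 (𝒜 pq.1) (ℬ pq.2)

/-- The positive part `X₊ = ⊕_{i>0} X_i` of a graded vector space. -/
def plusPart {M : Type} [AddCommGroup M] [Module 𝕜 M] (𝒜 : ℕ → Submodule 𝕜 M) :
    Submodule 𝕜 M :=
  ⨆ (i : ℕ) (_ : 0 < i), 𝒜 i

/-- The grading concentrating `𝒜 1` in degree `1` (and `⊥` elsewhere). -/
def degOne {M : Type} [AddCommGroup M] [Module 𝕜 M] (𝒜 : ℕ → Submodule 𝕜 M) :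
    ℕ → Submodule 𝕜 M :=
  fun n => if n = 1 then 𝒜 1 else ⊥

variable (A B : Type) [Ring A] [Algebra 𝕜 A] [Ring B] [Algebra 𝕜 B]

/-- `τ ∘ (μ_B ⊗ μ_A)` on `(B ⊗ B) ⊗ (A ⊗ A)`. -/
def twistLHS (τ : B ⊗[𝕜] A →ₗ[𝕜] A ⊗[𝕜] B) :
    (B ⊗[𝕜] B) ⊗[𝕜] (A ⊗[𝕜] A) →ₗ[𝕜] A ⊗[𝕜] B :=
  τ ∘ₗ TensorProduct.map (LinearMap.mul' 𝕜 B) (LinearMap.mul' 𝕜 A)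

/-- `(μ_A ⊗ μ_B) ∘ (1_A ⊗ τ ⊗ 1_B) ∘ (τ ⊗ τ) ∘ (1_B ⊗ τ ⊗ 1_A)` on `(B ⊗ B) ⊗ (A ⊗ A)`. -/
def twistRHS (τ : B ⊗[𝕜] A →ₗ[𝕜] A ⊗[𝕜] B) :
    (B ⊗[𝕜] B) ⊗[𝕜] (A ⊗[𝕜] A) →ₗ[𝕜] A ⊗[𝕜] B :=
  TensorProduct.map (LinearMap.mul' 𝕜 A) (LinearMap.mul' 𝕜 B)
    ∘ₗ (TensorProduct.assoc 𝕜 A A (B ⊗[𝕜] B)).symm.toLinearMap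
    ∘ₗ LinearMap.lTensor A (TensorProduct.assoc 𝕜 A B B).toLinearMap
    ∘ₗ LinearMap.lTensor A (LinearMap.rTensor B τ)
    ∘ₗ LinearMap.lTensor A (TensorProduct.assoc 𝕜 B A B).symm.toLinearMap
    ∘ₗ (TensorProduct.assoc 𝕜 A B (A ⊗[𝕜] B)).toLinearMap
    ∘ₗ TensorProduct.map τ τ
    ∘ₗ (TensorProduct.assoc 𝕜 B A (B ⊗[𝕜] A)).symm.toLinearMap
    ∘ₗ LinearMap.lTensor B (TensorProduct.assoc 𝕜 A B A).toLinearMap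
    ∘ₗ LinearMap.lTensor B (LinearMap.rTensor A τ)
    ∘ₗ LinearMap.lTensor B (TensorProduct.assoc 𝕜 B A A).symm.toLinearMap
    ∘ₗ (TensorProduct.assoc 𝕜 B B (A ⊗[𝕜] A)).toLinearMap

/-- `τ : B ⊗ A → A ⊗ B` is an (algebra) twisting map: it satisfies the unital twisting
conditions and `τ(μ_B ⊗ μ_A) = (μ_A ⊗ μ_B)(1_A ⊗ τ ⊗ 1_B)(τ ⊗ τ)(1_B ⊗ τ ⊗ 1_A)`. -/
def IsTwisting (τ : B ⊗[𝕜] A →ₗ[𝕜] A ⊗[𝕜] B) : Prop :=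
  (∀ a : A, τ ((1 : B) ⊗ₜ[𝕜] a) = a ⊗ₜ[𝕜] (1 : B)) ∧
  (∀ b : B, τ (b ⊗ₜ[𝕜] (1 : A)) = (1 : A) ⊗ₜ[𝕜] b) ∧
  twistLHS 𝕜 A B τ = twistRHS 𝕜 A B τ

/-- `τ` preserves the Künneth grading. -/
def IsGradedMapBA (𝒜 : ℕ → Submodule 𝕜 A) (ℬ : ℕ → Submodule 𝕜 B)
    (τ : B ⊗[𝕜] A →ₗ[𝕜] A ⊗[𝕜] B) : Prop :=
  ∀ n, Submodule.map τ (kunneth 𝕜 ℬ 𝒜 n) ≤ kunneth 𝕜 𝒜 ℬ n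

/-- `τ` is a graded twisting map. -/
def IsGradedTwisting (𝒜 : ℕ → Submodule 𝕜 A) (ℬ : ℕ → Submodule 𝕜 B)
    (τ : B ⊗[𝕜] A →ₗ[𝕜] A ⊗[𝕜] B) : Prop :=
  IsTwisting 𝕜 A B τ ∧ IsGradedMapBA 𝕜 A B 𝒜 ℬ τ

/-- A graded linear map `τ` is graded twisting to degree `n`:  it satisfies the unital
conditions and the twisting identity in all (Künneth) degrees `≤ n`. -/
def TwistingToDeg (𝒜 : ℕ → Submodule 𝕜 A) (ℬ : ℕ → Submodule 𝕜 B)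
    (τ : B ⊗[𝕜] A →ₗ[𝕜] A ⊗[𝕜] B) (n : ℕ) : Prop :=
  IsGradedMapBA 𝕜 A B 𝒜 ℬ τ ∧
  (∀ j ≤ n, ∀ a ∈ 𝒜 j, τ ((1 : B) ⊗ₜ[𝕜] a) = a ⊗ₜ[𝕜] (1 : B)) ∧
  (∀ j ≤ n, ∀ b ∈ ℬ j, τ (b ⊗ₜ[𝕜] (1 : A)) = (1 : A) ⊗ₜ[𝕜] b) ∧
  (∀ j ≤ n, ∀ x ∈ kunneth 𝕜 (kunneth 𝕜 ℬ ℬ) (kunneth 𝕜 𝒜 𝒜) j,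
    twistLHS 𝕜 A B τ x = twistRHS 𝕜 A B τ x)

/-- The unique extension property of a graded twisting map:  for every `n ≥ 3`, any
linear map `τ'` that is graded twisting to degree `n` and agrees with `τ` in all degrees
`< n` also agrees with `τ` in degree `n`. -/
def UEP (𝒜 : ℕ → Submodule 𝕜 A) (ℬ : ℕ → Submodule 𝕜 B)
    (τ : B ⊗[𝕜] A →ₗ[𝕜] A ⊗[𝕜] B) : Prop :=
  ∀ n, 3 ≤ n → ∀ τ' : B ⊗[𝕜] A →ₗ[𝕜] A ⊗[𝕜] B,
    TwistingToDeg 𝕜 A B 𝒜 ℬ τ' n →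
    (∀ i < n, ∀ x ∈ kunneth 𝕜 ℬ 𝒜 i, τ' x = τ x) →
    ∀ x ∈ kunneth 𝕜 ℬ 𝒜 n, τ' x = τ x

/-- The multiplication `μ_τ = (μ_A ⊗ μ_B)(1_A ⊗ τ ⊗ 1_B)` on `A ⊗ B`. -/
def mulTau (τ : B ⊗[𝕜] A →ₗ[𝕜] A ⊗[𝕜] B) :
    (A ⊗[𝕜] B) ⊗[𝕜] (A ⊗[𝕜] B) →ₗ[𝕜] A ⊗[𝕜] B :=
  TensorProduct.map (LinearMap.mul' 𝕜 A) (LinearMap.mul' 𝕜 B)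
    ∘ₗ (TensorProduct.assoc 𝕜 A A (B ⊗[𝕜] B)).symm.toLinearMap
    ∘ₗ LinearMap.lTensor A (TensorProduct.assoc 𝕜 A B B).toLinearMap
    ∘ₗ LinearMap.lTensor A (LinearMap.rTensor B τ)
    ∘ₗ LinearMap.lTensor A (TensorProduct.assoc 𝕜 B A B).symm.toLinearMap
    ∘ₗ (TensorProduct.assoc 𝕜 A B (A ⊗[𝕜] B)).toLinearMap

/-- `(C, ψ)` realizes the twisted tensor product algebra `A ⊗_τ B`:  `ψ` is a linear
isomorphism carrying the multiplication `μ_τ` and its unit to those of `C`. -/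
def Realizes (τ : B ⊗[𝕜] A →ₗ[𝕜] A ⊗[𝕜] B) (C : Type) [Ring C] [Algebra 𝕜 C]
    (ψ : A ⊗[𝕜] B →ₗ[𝕜] C) : Prop :=
  Function.Bijective ψ ∧ ψ ((1 : A) ⊗ₜ[𝕜] (1 : B)) = 1 ∧
  ∀ x y : A ⊗[𝕜] B, ψ (mulTau 𝕜 A B τ (x ⊗ₜ[𝕜] y)) = ψ x * ψ y

/-- The two-sided ideal generated by a subset, as a `𝕜`-submodule. -/
def idealSpan (C : Type) [Ring C] [Algebra 𝕜 C] (s : Set C) : Submodule 𝕜 C :=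
  Submodule.span 𝕜 {x | ∃ c d r, r ∈ s ∧ x = c * r * d}

/-- Weight grading of the tensor algebra. -/
def tensorWeight (V : Type) [AddCommGroup V] [Module 𝕜 V] (n : ℕ) :
    Submodule 𝕜 (TensorAlgebra 𝕜 V) :=
  LinearMap.range (TensorAlgebra.ι 𝕜 (M := V)) ^ n

instance (V : Type) [AddCommGroup V] [Module 𝕜 V] : GradedAlgebra (tensorWeight 𝕜 V) :=
  inferInstanceAs (GradedAlgebra
    ((LinearMap.range (TensorAlgebra.ι 𝕜 : V →ₗ[𝕜] TensorAlgebra 𝕜 V) ^ ·) : ℕ → Submodule 𝕜 _))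

/-- The canonical map `T(C₁) → C` for a graded algebra `C`. -/
def canMap (C : Type) [Ring C] [Algebra 𝕜 C] (𝒞 : ℕ → Submodule 𝕜 C) :
    TensorAlgebra 𝕜 ↥(𝒞 1) →ₐ[𝕜] C :=
  TensorAlgebra.lift 𝕜 (𝒞 1).subtype

/-- `C` (with grading `𝒞`) is a quadratic algebra: the canonical map `T(C₁) → C` is
surjective and its kernel is generated, as a two-sided ideal, by its degree 2 part. -/
def IsQuadraticAlg (C : Type) [Ring C] [Algebra 𝕜 C] (𝒞 : ℕ → Submodule 𝕜 C) : Prop :=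
  Function.Surjective (canMap 𝕜 C 𝒞) ∧
  LinearMap.ker (canMap 𝕜 C 𝒞).toLinearMap =
    idealSpan 𝕜 (TensorAlgebra 𝕜 ↥(𝒞 1))
      ((LinearMap.ker (canMap 𝕜 C 𝒞).toLinearMap ⊓ tensorWeight 𝕜 ↥(𝒞 1) 2 : Submodule 𝕜 _) : Set _)

/-- The left ideal generated by the positive part of a graded algebra. -/
def augIdeal (C : Type) [Ring C] [Algebra 𝕜 C] (𝒞 : ℕ → Submodule 𝕜 C) : Submodule C C :=
  Submodule.span C {x : C | ∃ i, 0 < i ∧ x ∈ 𝒞 i}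

/-- The degree `n` component of the graded free module on generators `σ` in degree `i`. -/
def freeGrade (C : Type) [Ring C] [Algebra 𝕜 C] (𝒞 : ℕ → Submodule 𝕜 C)
    (i : ℕ) (σ : Type) (n : ℕ) : Submodule 𝕜 (σ →₀ C) :=
  ⨅ (j : σ), Submodule.comap (Finsupp.lapply j : (σ →₀ C) →ₗ[𝕜] C)
    (if i ≤ n then 𝒞 (n - i) else ⊥)

/-- `C` (with grading `𝒞`) is a Koszul algebra: the trivial module `𝕜 = C/C₊` admits a
resolution by graded free modules with the `i`-th term generated in degree `i`. -/
def IsKoszul (C : Type) [Ring C] [Algebra 𝕜 C] (𝒞 : ℕ → Submodule 𝕜 C) : Prop :=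
  ∃ (σ : ℕ → Type) (d : ∀ i : ℕ, ((σ (i + 1)) →₀ C) →ₗ[C] ((σ i) →₀ C))
    (ε : ((σ 0) →₀ C) →ₗ[C] (C ⧸ augIdeal 𝕜 C 𝒞)),
    Function.Surjective ε ∧
    LinearMap.ker ε = LinearMap.range (d 0) ∧
    (∀ i, LinearMap.ker (d i) = LinearMap.range (d (i + 1))) ∧
    (∀ i n, ∀ x ∈ freeGrade 𝕜 C 𝒞 (i + 1) (σ (i + 1)) n, d i x ∈ freeGrade 𝕜 C 𝒞 i (σ i) n) ∧
    (∀ n, 0 < n → ∀ x ∈ freeGrade 𝕜 C 𝒞 0 (σ 0) n, ε x = 0)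

/-- `(P, ιA, ιB)` is a free product (coproduct) of `A` and `B`. -/
def IsFreeProduct (P : Type) [Ring P] [Algebra 𝕜 P] (ιA : A →ₐ[𝕜] P) (ιB : B →ₐ[𝕜] P) :
    Prop :=
  ∀ (C : Type) [Ring C] [Algebra 𝕜 C], ∀ (f : A →ₐ[𝕜] C) (g : B →ₐ[𝕜] C),
    ∃! h : P →ₐ[𝕜] C, h.comp ιA = f ∧ h.comp ιB = g

/-- The linear map `A ⊗ B → P`, `a ⊗ b ↦ ιA(a) · ιB(b)`. -/
def mulMapP (P : Type) [Ring P] [Algebra 𝕜 P] (ιA : A →ₐ[𝕜] P) (ιB : B →ₐ[𝕜] P) :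
    A ⊗[𝕜] B →ₗ[𝕜] P :=
  TensorProduct.lift (LinearMap.mk₂ 𝕜 (fun a b => ιA a * ιB b)
    (fun a a' b => by simp [map_add, add_mul])
    (fun c a b => by simp [map_smul, smul_mul_assoc])
    (fun a b b' => by simp [map_add, mul_add])
    (fun c a b => by simp [map_smul, mul_smul_comm]))

/-- The set of `τ`-relations `b ⊗ a - τ(b ⊗ a)` of total degree at most `n`,
inside the free product `P`. -/
def relSetLe (P : Type) [Ring P] [Algebra 𝕜 P] (ιA : A →ₐ[𝕜] P) (ιB : B →ₐ[𝕜] P)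
    (𝒜 : ℕ → Submodule 𝕜 A) (ℬ : ℕ → Submodule 𝕜 B)
    (τ : B ⊗[𝕜] A →ₗ[𝕜] A ⊗[𝕜] B) (n : ℕ) : Set P :=
  {x | ∃ i j a b, i + j ≤ n ∧ a ∈ 𝒜 i ∧ b ∈ ℬ j ∧
    x = ιB b * ιA a - mulMapP 𝕜 A B P ιA ιB (τ (b ⊗ₜ[𝕜] a))}

/-- The set of all `τ`-relations `b ⊗ a - τ(b ⊗ a)` inside the free product `P`. -/
def relSetAll (P : Type) [Ring P] [Algebra 𝕜 P] (ιA : A →ₐ[𝕜] P) (ιB : B →ₐ[𝕜] P)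
    (τ : B ⊗[𝕜] A →ₗ[𝕜] A ⊗[𝕜] B) : Set P :=
  {x | ∃ a b, x = ιB b * ιA a - mulMapP 𝕜 A B P ιA ιB (τ (b ⊗ₜ[𝕜] a))}

/-- The (Künneth) grading on the free product `P` of the graded algebras `A` and `B`. -/
def freeProdGrade (P : Type) [Ring P] [Algebra 𝕜 P] (ιA : A →ₐ[𝕜] P) (ιB : B →ₐ[𝕜] P)
    (𝒜 : ℕ → Submodule 𝕜 A) (ℬ : ℕ → Submodule 𝕜 B) (n : ℕ) : Submodule 𝕜 P :=
  ⨆ (l : List ℕ) (_ : l.sum = n),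
    ((l.map (fun i => Submodule.map ιA.toLinearMap (𝒜 i) ⊔ Submodule.map ιB.toLinearMap (ℬ i))).foldr
      (· * ·) 1)

end TTP

namespace TTP

section Modulo

variable {𝕜 A B : Type} [Field 𝕜] [Ring A] [Algebra 𝕜 A] [Ring B] [Algebra 𝕜 B]

variable (𝕜) in
/-- Left multiplication by `a` on the first factor and right multiplication by `b` on the second
factor of `A ⊗ B`. -/
def outerMul (a : A) (b : B) : A ⊗[𝕜] B →ₗ[𝕜] A ⊗[𝕜] B :=
  TensorProduct.map (LinearMap.mulLeft 𝕜 a) (LinearMap.mulRight 𝕜 b)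

@[simp]
lemma outerMul_tmul (a a' : A) (b b' : B) :
    outerMul 𝕜 a b (a' ⊗ₜ[𝕜] b') = (a * a') ⊗ₜ[𝕜] (b' * b) := by
  simp [outerMul]

@[simp]
lemma outerMul_one_one (x : A ⊗[𝕜] B) : outerMul 𝕜 1 1 x = x := by
  simp [outerMul]

lemma outerMul_outerMul (a a' : A) (b b' : B) (x : A ⊗[𝕜] B) :
    outerMul 𝕜 a b (outerMul 𝕜 a' b' x) = outerMul 𝕜 (a * a') (b' * b) x := by
  induction x using TensorProduct.induction_on with
  | zero => simp
  | tmul c d => simp [mul_assoc]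
  | add x y hx hy => simp only [map_add, hx, hy]

variable (τ : B ⊗[𝕜] A →ₗ[𝕜] A ⊗[𝕜] B)

lemma mulTau_tmul (a a' : A) (b b' : B) :
    mulTau 𝕜 A B τ ((a ⊗ₜ[𝕜] b) ⊗ₜ[𝕜] (a' ⊗ₜ[𝕜] b')) =
      outerMul 𝕜 a b' (τ (b ⊗ₜ[𝕜] a')) := by
  simp only [mulTau, LinearMap.comp_apply, LinearEquiv.coe_coe, TensorProduct.assoc_tmul,
    LinearMap.lTensor_tmul, TensorProduct.assoc_symm_tmul, LinearMap.rTensor_tmul]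
  induction τ (b ⊗ₜ[𝕜] a') using TensorProduct.induction_on with
  | zero => simp
  | tmul c d => simp
  | add x y hx hy => simp only [TensorProduct.add_tmul, TensorProduct.tmul_add, map_add, hx, hy]

lemma mulTau_outerMul (a : A) (b : B) (x y : A ⊗[𝕜] B) :
    mulTau 𝕜 A B τ (outerMul 𝕜 a 1 x ⊗ₜ[𝕜] outerMul 𝕜 1 b y) =
      outerMul 𝕜 a b (mulTau 𝕜 A B τ (x ⊗ₜ[𝕜] y)) := by
  induction x using TensorProduct.induction_on with
  | zero => simp
  | add x y hx hy => simp only [TensorProduct.add_tmul, map_add, hx, hy]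
  | tmul c d =>
    induction y using TensorProduct.induction_on with
    | zero => simp
    | add x y hx hy => simp only [TensorProduct.tmul_add, map_add, hx, hy]
    | tmul e f => simp [mulTau_tmul, outerMul_outerMul]

/-- The map `a ⊗ b ↦ μ_τ (τ (b₀ ⊗ a) ⊗ τ (b ⊗ a₀))`. -/
def mulTauTwist (b₀ : B) (a₀ : A) : A ⊗[𝕜] B →ₗ[𝕜] A ⊗[𝕜] B :=
  mulTau 𝕜 A B τ ∘ₗ TensorProduct.map (τ ∘ₗ TensorProduct.mk 𝕜 B A b₀)
    (τ ∘ₗ (TensorProduct.mk 𝕜 B A).flip a₀)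

@[simp]
lemma mulTauTwist_tmul (b₀ : B) (a₀ : A) (a : A) (b : B) :
    mulTauTwist τ b₀ a₀ (a ⊗ₜ[𝕜] b) =
      mulTau 𝕜 A B τ (τ (b₀ ⊗ₜ[𝕜] a) ⊗ₜ[𝕜] τ (b ⊗ₜ[𝕜] a₀)) := by
  simp [mulTauTwist]

lemma twistLHS_tmul (b b' : B) (a a' : A) :
    twistLHS 𝕜 A B τ ((b ⊗ₜ[𝕜] b') ⊗ₜ[𝕜] (a ⊗ₜ[𝕜] a')) = τ ((b * b') ⊗ₜ[𝕜] (a * a')) := by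
  simp [twistLHS]

lemma twistRHS_tmul (b b' : B) (a a' : A) :
    twistRHS 𝕜 A B τ ((b ⊗ₜ[𝕜] b') ⊗ₜ[𝕜] (a ⊗ₜ[𝕜] a')) =
      mulTauTwist τ b a' (τ (b' ⊗ₜ[𝕜] a)) := by
  simp only [twistRHS, LinearMap.comp_apply, LinearEquiv.coe_coe, TensorProduct.assoc_tmul,
    LinearMap.lTensor_tmul, TensorProduct.assoc_symm_tmul, LinearMap.rTensor_tmul]
  induction τ (b' ⊗ₜ[𝕜] a) using TensorProduct.induction_on with
  | zero => simp
  | tmul c d => simp [mulTau]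
  | add x y hx hy => simp only [TensorProduct.add_tmul, TensorProduct.tmul_add, map_add, hx, hy]

/-- `F` is stable under the outer multiplications and is a two-sided ideal for `μ_τ`. -/
structure IsMulTauIdeal (F : Submodule 𝕜 (A ⊗[𝕜] B)) : Prop where
  outer : ∀ a b, ∀ x ∈ F, outerMul 𝕜 a b x ∈ F
  left : ∀ x y, y ∈ F → mulTau 𝕜 A B τ (x ⊗ₜ[𝕜] y) ∈ F
  right : ∀ x y, x ∈ F → mulTau 𝕜 A B τ (x ⊗ₜ[𝕜] y) ∈ F

/-- `τ` satisfies the twisting conditions modulo `F`. -/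
structure IsTwistingMod (F : Submodule 𝕜 (A ⊗[𝕜] B)) : Prop where
  one_left : ∀ a : A, τ ((1 : B) ⊗ₜ[𝕜] a) ≡ a ⊗ₜ[𝕜] (1 : B) [SMOD F]
  one_right : ∀ b : B, τ (b ⊗ₜ[𝕜] (1 : A)) ≡ (1 : A) ⊗ₜ[𝕜] b [SMOD F]
  twist : ∀ x, twistLHS 𝕜 A B τ x ≡ twistRHS 𝕜 A B τ x [SMOD F]

/-- `μ_τ` is associative and unital modulo `F`. -/
structure IsAssocUnitalMod (F : Submodule 𝕜 (A ⊗[𝕜] B)) : Prop where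
  assoc : ∀ x y z : A ⊗[𝕜] B,
    mulTau 𝕜 A B τ ((mulTau 𝕜 A B τ (x ⊗ₜ[𝕜] y)) ⊗ₜ[𝕜] z) ≡
      mulTau 𝕜 A B τ (x ⊗ₜ[𝕜] (mulTau 𝕜 A B τ (y ⊗ₜ[𝕜] z))) [SMOD F]
  one_left : ∀ x : A ⊗[𝕜] B, mulTau 𝕜 A B τ (((1 : A) ⊗ₜ[𝕜] (1 : B)) ⊗ₜ[𝕜] x) ≡ x [SMOD F]
  one_right : ∀ x : A ⊗[𝕜] B, mulTau 𝕜 A B τ (x ⊗ₜ[𝕜] ((1 : A) ⊗ₜ[𝕜] (1 : B))) ≡ x [SMOD F]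

lemma isTwistingMod_iff (F : Submodule 𝕜 (A ⊗[𝕜] B)) : IsTwistingMod τ F ↔
    (∀ a : A, τ ((1 : B) ⊗ₜ[𝕜] a) ≡ a ⊗ₜ[𝕜] (1 : B) [SMOD F]) ∧
    (∀ b : B, τ (b ⊗ₜ[𝕜] (1 : A)) ≡ (1 : A) ⊗ₜ[𝕜] b [SMOD F]) ∧
    (∀ x, twistLHS 𝕜 A B τ x ≡ twistRHS 𝕜 A B τ x [SMOD F]) :=
  ⟨fun ⟨h1, h2, h3⟩ => ⟨h1, h2, h3⟩, fun ⟨h1, h2, h3⟩ => ⟨h1, h2, h3⟩⟩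

lemma isAssocUnitalMod_iff (F : Submodule 𝕜 (A ⊗[𝕜] B)) : IsAssocUnitalMod τ F ↔
    (∀ x y z : A ⊗[𝕜] B,
      mulTau 𝕜 A B τ ((mulTau 𝕜 A B τ (x ⊗ₜ[𝕜] y)) ⊗ₜ[𝕜] z) ≡
        mulTau 𝕜 A B τ (x ⊗ₜ[𝕜] (mulTau 𝕜 A B τ (y ⊗ₜ[𝕜] z))) [SMOD F]) ∧
    (∀ x : A ⊗[𝕜] B, mulTau 𝕜 A B τ (((1 : A) ⊗ₜ[𝕜] (1 : B)) ⊗ₜ[𝕜] x) ≡ x [SMOD F]) ∧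
    (∀ x : A ⊗[𝕜] B, mulTau 𝕜 A B τ (x ⊗ₜ[𝕜] ((1 : A) ⊗ₜ[𝕜] (1 : B))) ≡ x [SMOD F]) :=
  ⟨fun ⟨h1, h2, h3⟩ => ⟨h1, h2, h3⟩, fun ⟨h1, h2, h3⟩ => ⟨h1, h2, h3⟩⟩

variable {τ} {F : Submodule 𝕜 (A ⊗[𝕜] B)}

namespace IsMulTauIdeal

lemma outer_congr (hF : IsMulTauIdeal τ F) (a : A) (b : B) {x y : A ⊗[𝕜] B}
    (h : x ≡ y [SMOD F]) : outerMul 𝕜 a b x ≡ outerMul 𝕜 a b y [SMOD F] := by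
  rw [SModEq.sub_mem] at h ⊢
  simpa using hF.outer a b _ h

lemma mul_congr (hF : IsMulTauIdeal τ F) {x x' y y' : A ⊗[𝕜] B}
    (h : x ≡ x' [SMOD F]) (h' : y ≡ y' [SMOD F]) :
    mulTau 𝕜 A B τ (x ⊗ₜ[𝕜] y) ≡ mulTau 𝕜 A B τ (x' ⊗ₜ[𝕜] y') [SMOD F] := by
  rw [SModEq.sub_mem] at h h' ⊢
  have := F.add_mem (hF.right _ y h) (hF.left x' _ h')
  simpa [TensorProduct.sub_tmul, TensorProduct.tmul_sub] using this

end IsMulTauIdeal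

/-- Two linear maps out of a tensor product that agree modulo `F` on pure tensors agree
modulo `F`. -/
lemma smodEq_of_tmul {M N P : Type} [AddCommGroup M] [Module 𝕜 M] [AddCommGroup N] [Module 𝕜 N]
    [AddCommGroup P] [Module 𝕜 P] {F : Submodule 𝕜 P} (f g : M ⊗[𝕜] N →ₗ[𝕜] P)
    (h : ∀ m n, f (m ⊗ₜ[𝕜] n) ≡ g (m ⊗ₜ[𝕜] n) [SMOD F]) (x : M ⊗[𝕜] N) :
    f x ≡ g x [SMOD F] := by
  induction x using TensorProduct.induction_on with
  | zero => simp
  | tmul m n => exact h m n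
  | add x y hx hy => simpa only [map_add] using hx.add hy

namespace IsTwistingMod

lemma mul_one (h : IsTwistingMod τ F) (hF : IsMulTauIdeal τ F) (x : A ⊗[𝕜] B) :
    mulTau 𝕜 A B τ (x ⊗ₜ[𝕜] ((1 : A) ⊗ₜ[𝕜] (1 : B))) ≡ x [SMOD F] := by
  refine smodEq_of_tmul (mulTau 𝕜 A B τ ∘ₗ (TensorProduct.mk 𝕜 _ _).flip (1 ⊗ₜ[𝕜] 1))
    LinearMap.id (fun a b => ?_) x
  simpa [mulTau_tmul] using hF.outer_congr a 1 (h.one_right b)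

lemma one_mul (h : IsTwistingMod τ F) (hF : IsMulTauIdeal τ F) (x : A ⊗[𝕜] B) :
    mulTau 𝕜 A B τ (((1 : A) ⊗ₜ[𝕜] (1 : B)) ⊗ₜ[𝕜] x) ≡ x [SMOD F] := by
  refine smodEq_of_tmul (mulTau 𝕜 A B τ ∘ₗ TensorProduct.mk 𝕜 _ _ (1 ⊗ₜ[𝕜] 1))
    LinearMap.id (fun a b => ?_) x
  simpa [mulTau_tmul] using hF.outer_congr 1 b (h.one_left a)

lemma map_mul_tmul (h : IsTwistingMod τ F) (hF : IsMulTauIdeal τ F) (b b' : B) (a : A) :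
    τ ((b * b') ⊗ₜ[𝕜] a) ≡
      mulTau 𝕜 A B τ (((1 : A) ⊗ₜ[𝕜] b) ⊗ₜ[𝕜] τ (b' ⊗ₜ[𝕜] a)) [SMOD F] := by
  have key := h.twist ((b ⊗ₜ[𝕜] b') ⊗ₜ[𝕜] (a ⊗ₜ[𝕜] 1))
  rw [twistLHS_tmul, twistRHS_tmul, _root_.mul_one] at key
  refine key.trans (smodEq_of_tmul (mulTauTwist τ b 1)
    (mulTau 𝕜 A B τ ∘ₗ TensorProduct.mk 𝕜 _ _ (1 ⊗ₜ[𝕜] b)) (fun c d => ?_) _)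
  have h1 := hF.mul_congr (SModEq.refl (τ (b ⊗ₜ[𝕜] c))) (h.one_right d)
  have h2 := mulTau_outerMul τ 1 d (τ (b ⊗ₜ[𝕜] c)) (1 ⊗ₜ[𝕜] 1)
  simp only [outerMul_one_one, outerMul_tmul, _root_.one_mul] at h2
  rw [h2] at h1
  simpa [mulTau_tmul] using h1.trans (hF.outer_congr 1 d (h.mul_one hF _))

lemma map_tmul_mul (h : IsTwistingMod τ F) (hF : IsMulTauIdeal τ F) (b : B) (a a' : A) :
    τ (b ⊗ₜ[𝕜] (a * a')) ≡
      mulTau 𝕜 A B τ (τ (b ⊗ₜ[𝕜] a) ⊗ₜ[𝕜] (a' ⊗ₜ[𝕜] (1 : B))) [SMOD F] := by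
  have key := h.twist ((1 ⊗ₜ[𝕜] b) ⊗ₜ[𝕜] (a ⊗ₜ[𝕜] a'))
  rw [twistLHS_tmul, twistRHS_tmul, _root_.one_mul] at key
  refine key.trans (smodEq_of_tmul (mulTauTwist τ 1 a')
    (mulTau 𝕜 A B τ ∘ₗ (TensorProduct.mk 𝕜 _ _).flip (a' ⊗ₜ[𝕜] 1)) (fun c d => ?_) _)
  have h1 := hF.mul_congr (h.one_left c) (SModEq.refl (τ (d ⊗ₜ[𝕜] a')))
  have h2 := mulTau_outerMul τ c 1 (1 ⊗ₜ[𝕜] 1) (τ (d ⊗ₜ[𝕜] a'))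
  simp only [outerMul_one_one, outerMul_tmul, _root_.mul_one] at h2
  rw [h2] at h1
  simpa [mulTau_tmul] using h1.trans (hF.outer_congr c 1 (h.one_mul hF _))

lemma assoc_tmul (h : IsTwistingMod τ F) (hF : IsMulTauIdeal τ F) (a a' a'' : A) (b b' b'' : B) :
    mulTau 𝕜 A B τ
        ((mulTau 𝕜 A B τ ((a ⊗ₜ[𝕜] b) ⊗ₜ[𝕜] (a' ⊗ₜ[𝕜] b'))) ⊗ₜ[𝕜] (a'' ⊗ₜ[𝕜] b'')) ≡
      mulTau 𝕜 A B τ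
        ((a ⊗ₜ[𝕜] b) ⊗ₜ[𝕜] (mulTau 𝕜 A B τ ((a' ⊗ₜ[𝕜] b') ⊗ₜ[𝕜] (a'' ⊗ₜ[𝕜] b'')))) [SMOD F] := by
  have hl : mulTau 𝕜 A B τ (outerMul 𝕜 1 b' (τ (b ⊗ₜ[𝕜] a')) ⊗ₜ[𝕜] (a'' ⊗ₜ[𝕜] 1)) ≡
      mulTau 𝕜 A B τ (τ (b ⊗ₜ[𝕜] a') ⊗ₜ[𝕜] τ (b' ⊗ₜ[𝕜] a'')) [SMOD F] := by
    refine smodEq_of_tmul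
      (mulTau 𝕜 A B τ ∘ₗ (TensorProduct.mk 𝕜 _ _).flip (a'' ⊗ₜ[𝕜] 1) ∘ₗ outerMul 𝕜 1 b')
      (mulTau 𝕜 A B τ ∘ₗ (TensorProduct.mk 𝕜 _ _).flip (τ (b' ⊗ₜ[𝕜] a''))) (fun c d => ?_) _
    have h2 := mulTau_outerMul τ c 1 (1 ⊗ₜ[𝕜] d) (τ (b' ⊗ₜ[𝕜] a''))
    simp only [outerMul_one_one, outerMul_tmul, _root_.mul_one] at h2
    simpa [mulTau_tmul, h2] using hF.outer_congr c 1 (h.map_mul_tmul hF d b' a'')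
  have hr : mulTau 𝕜 A B τ ((1 ⊗ₜ[𝕜] b) ⊗ₜ[𝕜] outerMul 𝕜 a' 1 (τ (b' ⊗ₜ[𝕜] a''))) ≡
      mulTau 𝕜 A B τ (τ (b ⊗ₜ[𝕜] a') ⊗ₜ[𝕜] τ (b' ⊗ₜ[𝕜] a'')) [SMOD F] := by
    refine smodEq_of_tmul
      (mulTau 𝕜 A B τ ∘ₗ TensorProduct.mk 𝕜 _ _ (1 ⊗ₜ[𝕜] b) ∘ₗ outerMul 𝕜 a' 1)
      (mulTau 𝕜 A B τ ∘ₗ TensorProduct.mk 𝕜 _ _ (τ (b ⊗ₜ[𝕜] a'))) (fun c d => ?_) _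
    have h2 := mulTau_outerMul τ 1 d (τ (b ⊗ₜ[𝕜] a')) (c ⊗ₜ[𝕜] 1)
    simp only [outerMul_one_one, outerMul_tmul, _root_.one_mul] at h2
    simpa [mulTau_tmul, h2] using hF.outer_congr 1 d (h.map_tmul_mul hF b a' c)
  have hl' := mulTau_outerMul τ a b'' (outerMul 𝕜 1 b' (τ (b ⊗ₜ[𝕜] a'))) (a'' ⊗ₜ[𝕜] 1)
  have hr' := mulTau_outerMul τ a b'' (1 ⊗ₜ[𝕜] b) (outerMul 𝕜 a' 1 (τ (b' ⊗ₜ[𝕜] a'')))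
  simp only [outerMul_outerMul, outerMul_tmul, _root_.one_mul, _root_.mul_one] at hl' hr'
  rw [mulTau_tmul, mulTau_tmul, hl', hr']
  exact hF.outer_congr a b'' (hl.trans hr.symm)

lemma isAssocUnitalMod (h : IsTwistingMod τ F) (hF : IsMulTauIdeal τ F) :
    IsAssocUnitalMod τ F where
  assoc x y z := by
    induction x using TensorProduct.induction_on with
    | zero => simp
    | add x y hx hy => simpa only [TensorProduct.add_tmul, map_add] using hx.add hy
    | tmul a b =>
      induction y using TensorProduct.induction_on with
      | zero => simp
      | add x y hx hy =>
        simpa only [TensorProduct.add_tmul, TensorProduct.tmul_add, map_add] using hx.add hy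
      | tmul a' b' =>
        induction z using TensorProduct.induction_on with
        | zero => simp
        | add x y hx hy => simpa only [TensorProduct.tmul_add, map_add] using hx.add hy
        | tmul a'' b'' => exact h.assoc_tmul hF a a' a'' b b' b''
  one_left := h.one_mul hF
  one_right := h.mul_one hF

end IsTwistingMod

lemma IsAssocUnitalMod.isTwistingMod (h : IsAssocUnitalMod τ F) (hF : IsMulTauIdeal τ F) :
    IsTwistingMod τ F := by
  have hτ (b : B) (a : A) :
      mulTau 𝕜 A B τ (((1 : A) ⊗ₜ[𝕜] b) ⊗ₜ[𝕜] (a ⊗ₜ[𝕜] (1 : B))) = τ (b ⊗ₜ[𝕜] a) := by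
    simp [mulTau_tmul]
  have h1 (a : A) : τ ((1 : B) ⊗ₜ[𝕜] a) ≡ a ⊗ₜ[𝕜] (1 : B) [SMOD F] := by
    simpa [hτ] using h.one_left (a ⊗ₜ[𝕜] 1)
  have h2 (b : B) : τ (b ⊗ₜ[𝕜] (1 : A)) ≡ (1 : A) ⊗ₜ[𝕜] b [SMOD F] := by
    simpa [hτ] using h.one_right (1 ⊗ₜ[𝕜] b)
  have hA (a a' : A) : mulTau 𝕜 A B τ ((a ⊗ₜ[𝕜] (1 : B)) ⊗ₜ[𝕜] (a' ⊗ₜ[𝕜] (1 : B))) ≡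
      (a * a') ⊗ₜ[𝕜] (1 : B) [SMOD F] := by
    simpa [mulTau_tmul] using hF.outer_congr a 1 (h1 a')
  have hB (b b' : B) : mulTau 𝕜 A B τ (((1 : A) ⊗ₜ[𝕜] b) ⊗ₜ[𝕜] ((1 : A) ⊗ₜ[𝕜] b')) ≡
      (1 : A) ⊗ₜ[𝕜] (b * b') [SMOD F] := by
    simpa [mulTau_tmul] using hF.outer_congr 1 b' (h2 b)
  have hAB (a : A) (b : B) : mulTau 𝕜 A B τ ((a ⊗ₜ[𝕜] (1 : B)) ⊗ₜ[𝕜] ((1 : A) ⊗ₜ[𝕜] b)) ≡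
      a ⊗ₜ[𝕜] b [SMOD F] := by
    simpa [mulTau_tmul] using hF.outer_congr a b (h1 1)
  have twist (b b' : B) (a a' : A) :
      τ ((b * b') ⊗ₜ[𝕜] (a * a')) ≡ mulTauTwist τ b a' (τ (b' ⊗ₜ[𝕜] a)) [SMOD F] := by
    have hl : τ ((b * b') ⊗ₜ[𝕜] (a * a')) ≡ mulTau 𝕜 A B τ ((1 ⊗ₜ[𝕜] b) ⊗ₜ[𝕜]
        mulTau 𝕜 A B τ (τ (b' ⊗ₜ[𝕜] a) ⊗ₜ[𝕜] (a' ⊗ₜ[𝕜] 1))) [SMOD F] := by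
      rw [← hτ, ← hτ b']
      exact (hF.mul_congr (hB b b').symm (hA a a').symm).trans <| (h.assoc _ _ _).trans <|
        hF.mul_congr (SModEq.refl _) (h.assoc _ _ _).symm
    refine hl.trans (smodEq_of_tmul
      (mulTau 𝕜 A B τ ∘ₗ TensorProduct.mk 𝕜 _ _ (1 ⊗ₜ[𝕜] b) ∘ₗ
        mulTau 𝕜 A B τ ∘ₗ (TensorProduct.mk 𝕜 _ _).flip (a' ⊗ₜ[𝕜] 1))
      (mulTauTwist τ b a') (fun c d => ?_) _)
    simp only [LinearMap.comp_apply, TensorProduct.mk_apply, LinearMap.flip_apply,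
      mulTauTwist_tmul]
    rw [← hτ b c, ← hτ d a']
    exact ((h.assoc _ _ _).trans <| hF.mul_congr (SModEq.refl _) <| (h.assoc _ _ _).symm.trans <|
      hF.mul_congr (hAB c d) (SModEq.refl _)).symm
  refine ⟨h1, h2, fun x => ?_⟩
  induction x using TensorProduct.induction_on with
  | zero => simp
  | add x y hx hy => simpa only [map_add] using hx.add hy
  | tmul u v =>
    induction u using TensorProduct.induction_on with
    | zero => simp
    | add x y hx hy => simpa only [TensorProduct.add_tmul, map_add] using hx.add hy
    | tmul b b' =>
      induction v using TensorProduct.induction_on with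
      | zero => simp
      | add x y hx hy => simpa only [TensorProduct.tmul_add, map_add] using hx.add hy
      | tmul a a' => rw [twistLHS_tmul, twistRHS_tmul]; exact twist b b' a a'

lemma isMulTauIdeal_bot (τ : B ⊗[𝕜] A →ₗ[𝕜] A ⊗[𝕜] B) : IsMulTauIdeal τ ⊥ where
  outer := by simp
  left := by simp +contextual
  right := by simp +contextual

lemma IsMulTauIdeal.isTwistingMod_iff (hF : IsMulTauIdeal τ F) :
    IsTwistingMod τ F ↔ IsAssocUnitalMod τ F :=
  ⟨fun h => h.isAssocUnitalMod hF, fun h => h.isTwistingMod hF⟩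

end Modulo

section Graded

variable {𝕜 M N P : Type} [Field 𝕜] [AddCommGroup M] [Module 𝕜 M] [AddCommGroup N] [Module 𝕜 N]
  [AddCommGroup P] [Module 𝕜 P] {𝒢 : ℕ → Submodule 𝕜 M} {ℋ : ℕ → Submodule 𝕜 N}

lemma tmul_mem_kunneth {p q n : ℕ} (h : p + q = n) {x : M} {y : N} (hx : x ∈ 𝒢 p)
    (hy : y ∈ ℋ q) : x ⊗ₜ[𝕜] y ∈ kunneth 𝕜 𝒢 ℋ n :=
  Submodule.mem_iSup_of_mem (p, q) <| Submodule.mem_iSup_of_mem h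
    ⟨(⟨x, hx⟩ : 𝒢 p) ⊗ₜ (⟨y, hy⟩ : ℋ q), by simp⟩

lemma kunneth_le {n : ℕ} {S : Submodule 𝕜 (M ⊗[𝕜] N)}
    (h : ∀ p q, p + q = n → ∀ x ∈ 𝒢 p, ∀ y ∈ ℋ q, x ⊗ₜ[𝕜] y ∈ S) : kunneth 𝕜 𝒢 ℋ n ≤ S := by
  refine iSup₂_le ?_
  rintro ⟨p, q⟩ hpq _ ⟨t, rfl⟩
  induction t using TensorProduct.induction_on with
  | zero => simp
  | tmul x y => exact h p q hpq x x.2 y y.2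
  | add x y hx hy => simpa only [map_add] using S.add_mem hx hy

lemma map_mem_of_mem_kunneth (f : M ⊗[𝕜] N →ₗ[𝕜] P) {n : ℕ} {S : Submodule 𝕜 P}
    (h : ∀ p q, p + q = n → ∀ x ∈ 𝒢 p, ∀ y ∈ ℋ q, f (x ⊗ₜ[𝕜] y) ∈ S)
    {x : M ⊗[𝕜] N} (hx : x ∈ kunneth 𝕜 𝒢 ℋ n) : f x ∈ S :=
  kunneth_le (S := S.comap f) h hx

lemma iSup_kunneth (h𝒢 : ⨆ i, 𝒢 i = ⊤) (hℋ : ⨆ i, ℋ i = ⊤) :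
    ⨆ n, kunneth 𝕜 𝒢 ℋ n = ⊤ := by
  rw [eq_top_iff]
  rintro t -
  induction t using TensorProduct.induction_on with
  | zero => exact zero_mem _
  | add x y hx hy => exact add_mem hx hy
  | tmul x y =>
    have hx : x ∈ ⨆ i, 𝒢 i := h𝒢 ▸ Submodule.mem_top
    have hy : y ∈ ⨆ i, ℋ i := hℋ ▸ Submodule.mem_top
    induction hx using Submodule.iSup_induction' with
    | zero => simp
    | add x x' _ _ h h' => simpa only [TensorProduct.add_tmul] using add_mem h h'
    | mem p x hx =>
      induction hy using Submodule.iSup_induction' with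
      | zero => simp
      | add y y' _ _ h h' => simpa only [TensorProduct.tmul_add] using add_mem h h'
      | mem q y hy => exact Submodule.mem_iSup_of_mem (p + q) (tmul_mem_kunneth rfl hx hy)

variable (𝒢 ℋ) in
/-- The part of `M ⊗ N` of Künneth degree greater than `n`. -/
def kunnethGT (n : ℕ) : Submodule 𝕜 (M ⊗[𝕜] N) :=
  ⨆ (m : ℕ) (_ : n < m), kunneth 𝕜 𝒢 ℋ m

lemma kunneth_le_kunnethGT {n m : ℕ} (h : n < m) : kunneth 𝕜 𝒢 ℋ m ≤ kunnethGT 𝒢 ℋ n :=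
  le_iSup₂_of_le m h le_rfl

lemma map_mem_of_mem_kunnethGT (f : M ⊗[𝕜] N →ₗ[𝕜] P) {n : ℕ} {S : Submodule 𝕜 P}
    (h : ∀ m, n < m → ∀ x ∈ kunneth 𝕜 𝒢 ℋ m, f x ∈ S)
    {x : M ⊗[𝕜] N} (hx : x ∈ kunnethGT 𝒢 ℋ n) : f x ∈ S :=
  iSup₂_le (a := S.comap f) h hx

lemma induction_of_iSup_eq_top (h𝒢 : ⨆ i, 𝒢 i = ⊤) (f : M →ₗ[𝕜] P) {S : Submodule 𝕜 P}
    (h : ∀ i, ∀ x ∈ 𝒢 i, f x ∈ S) (x : M) : f x ∈ S :=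
  iSup_le (a := S.comap f) h (h𝒢 ▸ Submodule.mem_top : x ∈ ⨆ i, 𝒢 i)

variable {A B : Type} [Ring A] [Algebra 𝕜 A] [Ring B] [Algebra 𝕜 B]
    {𝒜 : ℕ → Submodule 𝕜 A} {ℬ : ℕ → Submodule 𝕜 B}
  {τ : B ⊗[𝕜] A →ₗ[𝕜] A ⊗[𝕜] B}

lemma IsGradedMapBA.mem (hgr : IsGradedMapBA 𝕜 A B 𝒜 ℬ τ) {n : ℕ} {x : B ⊗[𝕜] A}
    (hx : x ∈ kunneth 𝕜 ℬ 𝒜 n) : τ x ∈ kunneth 𝕜 𝒜 ℬ n :=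
  hgr n (Submodule.mem_map_of_mem hx)

/-- To check that a map out of `(B ⊗ B) ⊗ (A ⊗ A)` is graded it suffices to consider
homogeneous pure tensors. -/
lemma map_mem_of_mem_kunneth_kunneth (f : (B ⊗[𝕜] B) ⊗[𝕜] (A ⊗[𝕜] A) →ₗ[𝕜] P) {n : ℕ}
    {S : Submodule 𝕜 P}
    (h : ∀ p q r s, p + q + (r + s) = n → ∀ b ∈ ℬ p, ∀ b' ∈ ℬ q, ∀ a ∈ 𝒜 r, ∀ a' ∈ 𝒜 s,
      f ((b ⊗ₜ[𝕜] b') ⊗ₜ[𝕜] (a ⊗ₜ[𝕜] a')) ∈ S)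
    {x : (B ⊗[𝕜] B) ⊗[𝕜] (A ⊗[𝕜] A)}
    (hx : x ∈ kunneth 𝕜 (kunneth 𝕜 ℬ ℬ) (kunneth 𝕜 𝒜 𝒜) n) : f x ∈ S := by
  refine map_mem_of_mem_kunneth f (fun i j hij u hu v hv => ?_) hx
  refine map_mem_of_mem_kunneth (f ∘ₗ (TensorProduct.mk 𝕜 _ _).flip v)
    (fun p q hpq b hb b' hb' => ?_) hu
  refine map_mem_of_mem_kunneth (f ∘ₗ TensorProduct.mk 𝕜 _ _ (b ⊗ₜ[𝕜] b'))
    (fun r s hrs a ha a' ha' => ?_) hv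
  exact h p q r s (by omega) b hb b' hb' a ha a' ha'

variable [GradedAlgebra 𝒜] [GradedAlgebra ℬ]

variable (𝒜 ℬ) in
/-- The projection of `A ⊗ B` onto its component of Künneth degree `n`. -/
def kunnethProj (n : ℕ) : A ⊗[𝕜] B →ₗ[𝕜] A ⊗[𝕜] B :=
  ∑ pq ∈ Finset.HasAntidiagonal.antidiagonal n,
    TensorProduct.map (GradedAlgebra.proj 𝒜 pq.1) (GradedAlgebra.proj ℬ pq.2)

lemma kunnethProj_of_mem {n : ℕ} {x : A ⊗[𝕜] B} (hx : x ∈ kunneth 𝕜 𝒜 ℬ n) :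
    kunnethProj 𝒜 ℬ n x = x := by
  rw [← sub_eq_zero, ← Submodule.mem_bot 𝕜]
  refine map_mem_of_mem_kunneth (kunnethProj 𝒜 ℬ n - LinearMap.id) (fun p q hpq a ha b hb => ?_) hx
  rw [Submodule.mem_bot, LinearMap.sub_apply, sub_eq_zero, kunnethProj, LinearMap.sum_apply,
    Finset.sum_eq_single (p, q)]
  · simp [DirectSum.decompose_of_mem_same _ ha, DirectSum.decompose_of_mem_same _ hb]
  · rintro ⟨p', q'⟩ h' hne
    have : p ≠ p' := by
      rintro rfl
      rw [Finset.HasAntidiagonal.mem_antidiagonal] at h'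
      exact hne (Prod.ext rfl (by simp at h' ⊢; omega))
    simp [DirectSum.decompose_of_mem_ne _ ha this]
  · simp [hpq]

lemma kunnethProj_of_mem_ne {m n : ℕ} (h : m ≠ n) {x : A ⊗[𝕜] B} (hx : x ∈ kunneth 𝕜 𝒜 ℬ m) :
    kunnethProj 𝒜 ℬ n x = 0 := by
  rw [← Submodule.mem_bot 𝕜]
  refine map_mem_of_mem_kunneth _ (fun p q hpq a ha b hb => ?_) hx
  rw [Submodule.mem_bot, kunnethProj, LinearMap.sum_apply]
  refine Finset.sum_eq_zero ?_
  rintro ⟨p', q'⟩ h'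
  rw [Finset.HasAntidiagonal.mem_antidiagonal] at h'
  by_cases hp : p = p'
  · have hq : q ≠ q' := by rintro rfl; subst hp; exact h (hpq.symm.trans h')
    simp [DirectSum.decompose_of_mem_ne _ hb hq]
  · simp [DirectSum.decompose_of_mem_ne _ ha hp]

lemma eq_zero_of_mem_kunnethGT {j n : ℕ} (hj : j ≤ n) {x : A ⊗[𝕜] B}
    (hx : x ∈ kunneth 𝕜 𝒜 ℬ j) (hx' : x ∈ kunnethGT 𝒜 ℬ n) : x = 0 := by
  rw [← kunnethProj_of_mem hx, ← Submodule.mem_bot 𝕜]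
  exact map_mem_of_mem_kunnethGT _ (fun m hm y hy => (Submodule.mem_bot 𝕜).2 <|
    kunnethProj_of_mem_ne (by omega) hy) hx'

/-- Two graded linear maps agree modulo degrees `> n` if and only if they agree in
degrees `≤ n`. -/
lemma smodEq_kunnethGT_iff (h𝒢 : ⨆ i, 𝒢 i = ⊤) {f g : M →ₗ[𝕜] A ⊗[𝕜] B}
    (hf : ∀ j, ∀ x ∈ 𝒢 j, f x ∈ kunneth 𝕜 𝒜 ℬ j) (hg : ∀ j, ∀ x ∈ 𝒢 j, g x ∈ kunneth 𝕜 𝒜 ℬ j)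
    (n : ℕ) :
    (∀ x, f x ≡ g x [SMOD kunnethGT 𝒜 ℬ n]) ↔ ∀ j ≤ n, ∀ x ∈ 𝒢 j, f x = g x := by
  simp only [SModEq.sub_mem]
  refine ⟨fun h j hj x hx => sub_eq_zero.1 <|
    eq_zero_of_mem_kunnethGT hj (sub_mem (hf j x hx) (hg j x hx)) (h x), fun h =>
    induction_of_iSup_eq_top h𝒢 (f - g) fun j x hx => ?_⟩
  rcases le_or_gt j n with hj | hj
  · simp [h j hj x hx]
  · exact kunneth_le_kunnethGT hj (sub_mem (hf j x hx) (hg j x hx))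

lemma iSup_grading_eq_top (𝒜 : ℕ → Submodule 𝕜 A) [GradedAlgebra 𝒜] : ⨆ i, 𝒜 i = ⊤ :=
  (DirectSum.Decomposition.isInternal 𝒜).submodule_iSup_eq_top

lemma outerMul_mem_kunneth {p q m n : ℕ} (h : p + m + q = n) {a : A} {b : B} (ha : a ∈ 𝒜 p)
    (hb : b ∈ ℬ q) {x : A ⊗[𝕜] B} (hx : x ∈ kunneth 𝕜 𝒜 ℬ m) :
    outerMul 𝕜 a b x ∈ kunneth 𝕜 𝒜 ℬ n := by
  refine map_mem_of_mem_kunneth _ (fun r s hrs c hc d hd => ?_) hx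
  rw [outerMul_tmul]
  exact tmul_mem_kunneth (by omega) (SetLike.mul_mem_graded ha hc) (SetLike.mul_mem_graded hd hb)

lemma mulTau_mem_kunneth (hgr : IsGradedMapBA 𝕜 A B 𝒜 ℬ τ) {m n : ℕ} {x y : A ⊗[𝕜] B}
    (hx : x ∈ kunneth 𝕜 𝒜 ℬ m) (hy : y ∈ kunneth 𝕜 𝒜 ℬ n) :
    mulTau 𝕜 A B τ (x ⊗ₜ[𝕜] y) ∈ kunneth 𝕜 𝒜 ℬ (m + n) := by
  refine map_mem_of_mem_kunneth (mulTau 𝕜 A B τ ∘ₗ (TensorProduct.mk 𝕜 _ _).flip y)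
    (fun p q hpq a ha b hb => ?_) hx
  refine map_mem_of_mem_kunneth (mulTau 𝕜 A B τ ∘ₗ TensorProduct.mk 𝕜 _ _ (a ⊗ₜ[𝕜] b))
    (fun r s hrs c hc d hd => ?_) hy
  simp only [LinearMap.comp_apply, TensorProduct.mk_apply, mulTau_tmul]
  exact outerMul_mem_kunneth (by omega) ha hd (hgr.mem (tmul_mem_kunneth rfl hb hc))

lemma mulTauTwist_mem_kunneth (hgr : IsGradedMapBA 𝕜 A B 𝒜 ℬ τ) {p q m n : ℕ} (h : p + m + q = n)
    {b : B} {a : A} (hb : b ∈ ℬ p) (ha : a ∈ 𝒜 q) {x : A ⊗[𝕜] B} (hx : x ∈ kunneth 𝕜 𝒜 ℬ m) :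
    mulTauTwist τ b a x ∈ kunneth 𝕜 𝒜 ℬ n := by
  refine map_mem_of_mem_kunneth _ (fun r s hrs c hc d hd => ?_) hx
  have : (p + r) + (s + q) = n := by omega
  rw [mulTauTwist_tmul, ← this]
  exact mulTau_mem_kunneth hgr (hgr.mem (tmul_mem_kunneth rfl hb hc))
    (hgr.mem (tmul_mem_kunneth rfl hd ha))

lemma twistLHS_mem_kunneth (hgr : IsGradedMapBA 𝕜 A B 𝒜 ℬ τ) {n : ℕ}
    {x : (B ⊗[𝕜] B) ⊗[𝕜] (A ⊗[𝕜] A)}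
    (hx : x ∈ kunneth 𝕜 (kunneth 𝕜 ℬ ℬ) (kunneth 𝕜 𝒜 𝒜) n) :
    twistLHS 𝕜 A B τ x ∈ kunneth 𝕜 𝒜 ℬ n := by
  refine map_mem_of_mem_kunneth_kunneth _ (fun p q r s h b hb b' hb' a ha a' ha' => ?_) hx
  rw [twistLHS_tmul]
  exact hgr.mem (tmul_mem_kunneth h (SetLike.mul_mem_graded hb hb') (SetLike.mul_mem_graded ha ha'))

lemma twistRHS_mem_kunneth (hgr : IsGradedMapBA 𝕜 A B 𝒜 ℬ τ) {n : ℕ}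
    {x : (B ⊗[𝕜] B) ⊗[𝕜] (A ⊗[𝕜] A)}
    (hx : x ∈ kunneth 𝕜 (kunneth 𝕜 ℬ ℬ) (kunneth 𝕜 𝒜 𝒜) n) :
    twistRHS 𝕜 A B τ x ∈ kunneth 𝕜 𝒜 ℬ n := by
  refine map_mem_of_mem_kunneth_kunneth _ (fun p q r s h b hb b' hb' a ha a' ha' => ?_) hx
  rw [twistRHS_tmul]
  exact mulTauTwist_mem_kunneth hgr (by omega) hb ha' (hgr.mem (tmul_mem_kunneth rfl hb' ha))

lemma isMulTauIdeal_kunnethGT (hgr : IsGradedMapBA 𝕜 A B 𝒜 ℬ τ) (n : ℕ) :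
    IsMulTauIdeal τ (kunnethGT 𝒜 ℬ n) := by
  have htop := iSup_kunneth (iSup_grading_eq_top 𝒜) (iSup_grading_eq_top ℬ)
  refine ⟨fun a b x hx => map_mem_of_mem_kunnethGT _ (fun m hm x hx => ?_) hx,
    fun x y hy => map_mem_of_mem_kunnethGT (mulTau 𝕜 A B τ ∘ₗ TensorProduct.mk 𝕜 _ _ x)
      (fun m hm y hy => ?_) hy,
    fun x y hx => map_mem_of_mem_kunnethGT (mulTau 𝕜 A B τ ∘ₗ (TensorProduct.mk 𝕜 _ _).flip y)
      (fun m hm x hx => ?_) hx⟩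
  · refine map_mem_of_mem_kunneth _ (fun p q hpq c hc d hd => ?_) hx
    rw [outerMul_tmul]
    refine induction_of_iSup_eq_top (iSup_grading_eq_top 𝒜)
      ((TensorProduct.mk 𝕜 A B).flip (d * b) ∘ₗ LinearMap.mulRight 𝕜 c) (fun i a ha => ?_) a
    refine induction_of_iSup_eq_top (iSup_grading_eq_top ℬ)
      (TensorProduct.mk 𝕜 A B (a * c) ∘ₗ LinearMap.mulLeft 𝕜 d) (fun j b hb => ?_) b
    exact kunneth_le_kunnethGT (by omega : n < (i + p) + (q + j)) <|
      tmul_mem_kunneth rfl (SetLike.mul_mem_graded ha hc) (SetLike.mul_mem_graded hd hb)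
  · exact induction_of_iSup_eq_top htop (mulTau 𝕜 A B τ ∘ₗ (TensorProduct.mk 𝕜 _ _).flip y)
      (fun i x hx => kunneth_le_kunnethGT (by omega) (mulTau_mem_kunneth hgr hx hy)) x
  · exact induction_of_iSup_eq_top htop (mulTau 𝕜 A B τ ∘ₗ TensorProduct.mk 𝕜 _ _ x)
      (fun i y hy => kunneth_le_kunnethGT (by omega) (mulTau_mem_kunneth hgr hx hy)) y

lemma twistingToDeg_iff (hgr : IsGradedMapBA 𝕜 A B 𝒜 ℬ τ) (n : ℕ) :
    TwistingToDeg 𝕜 A B 𝒜 ℬ τ n ↔ IsTwistingMod τ (kunnethGT 𝒜 ℬ n) := by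
  have hA := iSup_grading_eq_top 𝒜
  have hB := iSup_grading_eq_top ℬ
  have h1 := smodEq_kunnethGT_iff hA (f := τ ∘ₗ TensorProduct.mk 𝕜 B A 1)
    (g := (TensorProduct.mk 𝕜 A B).flip 1)
    (fun j a ha => hgr.mem (tmul_mem_kunneth (zero_add j) SetLike.GradedOne.one_mem ha))
    (fun j a ha => tmul_mem_kunneth (add_zero j) ha SetLike.GradedOne.one_mem) n
  have h2 := smodEq_kunnethGT_iff hB (f := τ ∘ₗ (TensorProduct.mk 𝕜 B A).flip 1)
    (g := TensorProduct.mk 𝕜 A B 1)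
    (fun j b hb => hgr.mem (tmul_mem_kunneth (add_zero j) hb SetLike.GradedOne.one_mem))
    (fun j b hb => tmul_mem_kunneth (zero_add j) SetLike.GradedOne.one_mem hb) n
  have h3 := smodEq_kunnethGT_iff (iSup_kunneth (iSup_kunneth hB hB) (iSup_kunneth hA hA))
    (fun j x hx => twistLHS_mem_kunneth hgr hx) (fun j x hx => twistRHS_mem_kunneth hgr hx) n
  rw [isTwistingMod_iff, TwistingToDeg]
  exact (and_iff_right hgr).trans (and_congr h1.symm (and_congr h2.symm h3.symm))

end Graded

/-- Proposition 2.3 (`multiplications`).  Let `A`, `B` be (connected, locally finite)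
graded algebras and `τ : B ⊗ A → A ⊗ B` a graded linear map, and let
`μ_τ = (μ_A ⊗ μ_B)(1_A ⊗ τ ⊗ 1_B)`.  Then (1) `τ` is a (graded) twisting map iff `μ_τ` is
an associative multiplication making `A ⊗ B` a graded unital algebra, and (2) for each
`n`, `τ` is graded twisting to degree `n` iff `μ_τ` induces an associative unital
multiplication on the quotient `(A ⊗ B)/(A ⊗ B)_{>n}`. -/
theorem stmt0 (𝕜 : Type) [Field 𝕜] (A B : Type) [Ring A] [Algebra 𝕜 A] [Ring B] [Algebra 𝕜 B]
    (𝒜 : ℕ → Submodule 𝕜 A) (ℬ : ℕ → Submodule 𝕜 B)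
    [GradedAlgebra 𝒜] [GradedAlgebra ℬ]
    (hconnA : 𝒜 0 = (1 : Submodule 𝕜 A)) (hconnB : ℬ 0 = (1 : Submodule 𝕜 B))
    (hlfA : ∀ n, Module.Finite 𝕜 ↥(𝒜 n)) (hlfB : ∀ n, Module.Finite 𝕜 ↥(ℬ n))
    (τ : B ⊗[𝕜] A →ₗ[𝕜] A ⊗[𝕜] B)
    (hgr : IsGradedMapBA 𝕜 A B 𝒜 ℬ τ) :
    (IsTwisting 𝕜 A B τ ↔
      ((∀ x y z : A ⊗[𝕜] B,
          mulTau 𝕜 A B τ ((mulTau 𝕜 A B τ (x ⊗ₜ[𝕜] y)) ⊗ₜ[𝕜] z) =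
          mulTau 𝕜 A B τ (x ⊗ₜ[𝕜] (mulTau 𝕜 A B τ (y ⊗ₜ[𝕜] z)))) ∧
       (∀ x : A ⊗[𝕜] B, mulTau 𝕜 A B τ (((1 : A) ⊗ₜ[𝕜] (1 : B)) ⊗ₜ[𝕜] x) = x) ∧
       (∀ x : A ⊗[𝕜] B, mulTau 𝕜 A B τ (x ⊗ₜ[𝕜] ((1 : A) ⊗ₜ[𝕜] (1 : B))) = x) ∧
       (∀ m n : ℕ, ∀ x ∈ kunneth 𝕜 𝒜 ℬ m, ∀ y ∈ kunneth 𝕜 𝒜 ℬ n,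
          mulTau 𝕜 A B τ (x ⊗ₜ[𝕜] y) ∈ kunneth 𝕜 𝒜 ℬ (m + n)))) ∧
    (∀ n : ℕ,
      TwistingToDeg 𝕜 A B 𝒜 ℬ τ n ↔
      ((∀ x y z : A ⊗[𝕜] B,
          mulTau 𝕜 A B τ ((mulTau 𝕜 A B τ (x ⊗ₜ[𝕜] y)) ⊗ₜ[𝕜] z) -
            mulTau 𝕜 A B τ (x ⊗ₜ[𝕜] (mulTau 𝕜 A B τ (y ⊗ₜ[𝕜] z))) ∈
          (⨆ (m : ℕ) (_ : n < m), kunneth 𝕜 𝒜 ℬ m)) ∧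
       (∀ x : A ⊗[𝕜] B,
          mulTau 𝕜 A B τ (((1 : A) ⊗ₜ[𝕜] (1 : B)) ⊗ₜ[𝕜] x) - x ∈
          (⨆ (m : ℕ) (_ : n < m), kunneth 𝕜 𝒜 ℬ m)) ∧
       (∀ x : A ⊗[𝕜] B,
          mulTau 𝕜 A B τ (x ⊗ₜ[𝕜] ((1 : A) ⊗ₜ[𝕜] (1 : B))) - x ∈
          (⨆ (m : ℕ) (_ : n < m), kunneth 𝕜 𝒜 ℬ m)))) := by
  refine ⟨?_, fun n => ?_⟩
  · have key := (isMulTauIdeal_bot τ).isTwistingMod_iff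
    simp only [isTwistingMod_iff, isAssocUnitalMod_iff, SModEq.bot] at key
    rw [IsTwisting, LinearMap.ext_iff, key]
    exact ⟨fun ⟨h1, h2, h3⟩ => ⟨h1, h2, h3, fun m n x hx y hy => mulTau_mem_kunneth hgr hx hy⟩,
      fun ⟨h1, h2, h3, _⟩ => ⟨h1, h2, h3⟩⟩
  · simp only [← SModEq.sub_mem]
    rw [twistingToDeg_iff hgr, (isMulTauIdeal_kunnethGT hgr n).isTwistingMod_iff,
      isAssocUnitalMod_iff]
    rfl

end TTP
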